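/- arXiv:2403.00129 — 2 statements merged into one kernel-verified Lean document; each statement's English description precedes it below -/
import Mathlib

section
/- There is a constant c_μ such that the following holds for all sufficiently large n and all μ with c_μ·(ln n)² ≤ μ ≤ n. Set c_m = (n/e²)·(3e²·ln(n)/μ)^m for integers m ≥ 1, and M = ln(n/e²)/ln(μ/(3e²·ln n)). For G ← G_ua(n,μ), with probability at least 1 − 2/n² all of the following hold simultaneously: (1) every vertex i > ⌈c₁⌉ is adjacent to some vertex j ≤ ⌈c₁⌉; (2) for every integer m with 1 ≤ m ≤ M − 1, every vertex i with ⌈c_{m+1}⌉ < i < e²·c_m is adjacent to some vertex j ≤ ⌈c_{m+1}⌉; (3) each of the vertices 2, 3, …, 7 is adjacent to vertex 1. -/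
open MeasureTheory
open scoped ENNReal

/-- Coordinate measure for the uniform attachment process: the uniform distribution on
`{0, …, i − 1}` (for `i = 0` there is no real choice; a dummy Dirac mass is used, and the
corresponding coordinates are never read by the graph). -/
noncomputable def uaCoord (i : ℕ) : Measure ℕ :=
  if h : 0 < i then
    (PMF.uniformOfFinset (Finset.range i) (Finset.nonempty_range_iff.mpr h.ne')).toMeasure
  else Measure.dirac 0

/-- The uniform attachment measure on choice sequences: vertices are `0, …, n − 1` in
arrival order (vertex `i : Fin n` has 1-indexed arrival time `i + 1`); the choices
`ω (i, s)` for `0 < i`, `s < μ` are independent and uniform on `{0, …, i − 1}`. -/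
noncomputable def uaMeasure (n μ : ℕ) : Measure (Fin n × Fin μ → ℕ) :=
  Measure.pi fun p => uaCoord (p.1 : ℕ)

/-- Adjacency in the uniform attachment multigraph: some edge joins `u` and `v`. -/
def uaAdj (n μ : ℕ) (ω : Fin n × Fin μ → ℕ) (u v : Fin n) : Prop :=
  ∃ s : Fin μ, (0 < (u : ℕ) ∧ ω (u, s) = (v : ℕ)) ∨ (0 < (v : ℕ) ∧ ω (v, s) = (u : ℕ))

/-- The degree (with edge multiplicities) of vertex `i`: the `μ` edges it created upon
arrival (none for the very first vertex) plus the edges later vertices attached to it. -/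
noncomputable def uaDeg (n μ : ℕ) (ω : Fin n × Fin μ → ℕ) (i : Fin n) : ℕ :=
  (if 0 < (i : ℕ) then μ else 0) + {p : Fin n × Fin μ | i < p.1 ∧ ω p = (i : ℕ)}.ncard

/-- The 1-indexed arrival time (label) of a vertex. -/
def lab {n : ℕ} (v : Fin n) : ℕ := (v : ℕ) + 1

/-- The `k`-th harmonic number, as a real number. -/
noncomputable def harm (k : ℕ) : ℝ := ∑ i ∈ Finset.range k, (1 : ℝ) / (i + 1)

/-- `c_m = (n/e²)·(3e²·ln(n)/μ)^m`. -/
noncomputable def uaCenter (n μ : ℕ) (m : ℕ) : ℝ :=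
  ((n : ℝ) / Real.exp 2) * (3 * Real.exp 2 * Real.log n / μ) ^ m

/-- `M = ln(n/e²)/ln(μ/(3e²·ln n))`. -/
noncomputable def uaM (n μ : ℕ) : ℝ :=
  Real.log ((n : ℝ) / Real.exp 2) / Real.log ((μ : ℝ) / (3 * Real.exp 2 * Real.log n))

instance uaCoord.instIsProbabilityMeasure (i : ℕ) : IsProbabilityMeasure (uaCoord i) := by
  unfold uaCoord
  split_ifs <;> infer_instance

lemma uaCoord_notMem_range {i k : ℕ} (hi : 0 < i) (hk : k ≤ i) :
    uaCoord i {x | x ∉ Finset.range k} = ENNReal.ofReal (1 - k / i) := by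
  classical
  have hfilter : (Finset.range i).filter (fun x => x ∈ {x | x ∉ Finset.range k}) =
      Finset.Ico k i := by
    ext x
    simp only [Finset.mem_filter, Finset.mem_range, Set.mem_ofPred_eq, Finset.mem_Ico]
    omega
  rw [uaCoord, dif_pos hi,
    PMF.toMeasure_uniformOfFinset_apply _ _ MeasurableSet.of_discrete]
  have hi' : (0 : ℝ) < i := by exact_mod_cast hi
  have hcard : ((Finset.range i).filter (fun x => x ∈ {x | x ∉ Finset.range k})).card = i - k := by
    rw [← Nat.card_Ico, ← hfilter]
  have hreal : (1 : ℝ) - k / i = ((i - k : ℕ) : ℝ) / i := by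
    rw [Nat.cast_sub hk]
    field_simp
  rw [hreal, ENNReal.ofReal_div_of_pos hi', ENNReal.ofReal_natCast, ENNReal.ofReal_natCast,
    Finset.card_range, ← hcard]
  congr!

/-- The event that vertex `i` sends no edge to the first `k` vertices. -/
def uaMissSet (n μ : ℕ) (i : Fin n) (k : ℕ) : Set (Fin n × Fin μ → ℕ) :=
  {ω | ∀ s, ω (i, s) ∉ Finset.range k}

lemma uaMeasure_uaMissSet {n μ : ℕ} (i : Fin n) (k : ℕ) :
    uaMeasure n μ (uaMissSet n μ i k) = uaCoord i {x | x ∉ Finset.range k} ^ μ := by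
  have hpi : uaMissSet n μ i k = Set.pi Set.univ
      (fun p : Fin n × Fin μ => if p.1 = i then {x | x ∉ Finset.range k} else Set.univ) := by
    ext ω
    simp only [uaMissSet, Set.mem_ofPred_eq, Set.mem_pi, Set.mem_univ, true_implies, Prod.forall]
    constructor
    · intro h a s
      split_ifs with ha
      · subst ha
        exact h s
      · trivial
    · intro h s
      simpa using h i s
  rw [hpi, uaMeasure, Measure.pi_pi, Fintype.prod_prod_type,
    Finset.prod_eq_single_of_mem i (Finset.mem_univ i)]
  · simp
  · intro a _ ha
    simp [ha]

lemma uaMeasure_uaMissSet_le {n μ : ℕ} (hμ : 0 < μ) (i : Fin n) (hi : 0 < (i : ℕ)) {k : ℕ} {t : ℝ}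
    (hk : t * i ≤ μ * k) :
    uaMeasure n μ (uaMissSet n μ i (min k i)) ≤ ENNReal.ofReal (Real.exp (-t)) := by
  have hi' : (0 : ℝ) < (i : ℕ) := by exact_mod_cast hi
  rw [uaMeasure_uaMissSet, uaCoord_notMem_range hi (min_le_right _ _)]
  rcases le_total (i : ℕ) k with h | h
  · rw [min_eq_right h, div_self hi'.ne']
    simp [hμ.ne']
  · have hki : (k : ℝ) ≤ (i : ℕ) := by exact_mod_cast h
    have hnonneg : (0 : ℝ) ≤ 1 - k / (i : ℕ) := by
      rw [sub_nonneg, div_le_one hi']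
      exact hki
    rw [min_eq_left h, ← ENNReal.ofReal_pow hnonneg]
    apply ENNReal.ofReal_le_ofReal
    calc (1 - (k : ℝ) / (i : ℕ)) ^ μ ≤ Real.exp (-(k / (i : ℕ))) ^ μ :=
          pow_le_pow_left₀ hnonneg (Real.one_sub_le_exp_neg _) μ
      _ = Real.exp (-(μ * k / (i : ℕ))) := by
          rw [← Real.exp_nat_mul]
          congr 1
          ring
      _ ≤ Real.exp (-t) := by
          rw [Real.exp_le_exp, neg_le_neg_iff, le_div_iff₀ hi']
          exact hk

lemma exists_uaAdj_of_notMem_uaMissSet {n μ : ℕ} {ω : Fin n × Fin μ → ℕ} {i : Fin n}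
    (hi : 0 < (i : ℕ)) {k : ℕ} (h : ω ∉ uaMissSet n μ i (min k i)) {K : ℕ} (hkK : k ≤ K) :
    ∃ j : Fin n, lab j ≤ K ∧ uaAdj n μ ω i j := by
  simp only [uaMissSet, Set.mem_ofPred_eq, not_forall, not_not, Finset.mem_range, lt_min_iff] at h
  obtain ⟨s, hsk, hsi⟩ := h
  exact ⟨⟨ω (i, s), hsi.trans i.2⟩, hsk.trans_le hkK, s, Or.inl ⟨hi, rfl⟩⟩

lemma uaCenter_pos {n μ : ℕ} (hn : 1 < n) (hμ : 0 < μ) (m : ℕ) : 0 < uaCenter n μ m := by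
  have hlog : 0 < Real.log n := Real.log_pos (by exact_mod_cast hn)
  have hn' : (0 : ℝ) < n := by positivity
  have hμ' : (0 : ℝ) < μ := by exact_mod_cast hμ
  unfold uaCenter
  positivity

lemma uaCenter_succ (n μ m : ℕ) :
    uaCenter n μ (m + 1) = 3 * Real.log n / μ * (Real.exp 2 * uaCenter n μ m) := by
  simp only [uaCenter, pow_succ]
  ring

/-- The failure probabilities of the individual vertices add up to at most `1 / n²`. -/
lemma uaMeasure_iUnion_uaMissSet_le {n μ : ℕ} (hn : 0 < n) (hμ : 0 < μ) :
    uaMeasure n μ (⋃ i : Fin n, ⋃ _ : 0 < (i : ℕ),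
      uaMissSet n μ i (min ⌈3 * Real.log n / μ * (i : ℕ)⌉₊ i)) ≤ 1 / (n : ℝ≥0∞) ^ 2 := by
  have hn' : (0 : ℝ) < n := by exact_mod_cast hn
  have hμ' : (0 : ℝ) < μ := by exact_mod_cast hμ
  have hexp : Real.exp (-(3 * Real.log n)) = ((n : ℝ) ^ 3)⁻¹ := by
    rw [Real.exp_neg, mul_comm, Real.exp_mul, Real.exp_log hn']
    norm_cast
  have hmiss (i : Fin n) : uaMeasure n μ (⋃ _ : 0 < (i : ℕ),
      uaMissSet n μ i (min ⌈3 * Real.log n / μ * (i : ℕ)⌉₊ i)) ≤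
        ENNReal.ofReal (((n : ℝ) ^ 3)⁻¹) := by
    by_cases hi : 0 < (i : ℕ)
    · simp only [hi, Set.iUnion_true]
      rw [← hexp]
      refine uaMeasure_uaMissSet_le hμ i hi ?_
      calc 3 * Real.log n * (i : ℕ) = μ * (3 * Real.log n / μ * (i : ℕ)) := by field_simp
        _ ≤ μ * ⌈3 * Real.log n / μ * (i : ℕ)⌉₊ := by gcongr; exact Nat.le_ceil _
    · simp [hi]
  calc _ ≤ ∑ i : Fin n, ENNReal.ofReal (((n : ℝ) ^ 3)⁻¹) :=
        (measure_iUnion_fintype_le _ _).trans (Finset.sum_le_sum fun i _ => hmiss i)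
    _ = ENNReal.ofReal (1 / (n : ℝ) ^ 2) := by
        rw [Finset.sum_const, Finset.card_univ, Fintype.card_fin, nsmul_eq_mul,
          ← ENNReal.ofReal_natCast, ← ENNReal.ofReal_mul hn'.le]
        congr 1
        field_simp
    _ = 1 / (n : ℝ≥0∞) ^ 2 := by
        rw [ENNReal.ofReal_div_of_pos (by positivity), ENNReal.ofReal_one,
          ENNReal.ofReal_pow hn'.le, ENNReal.ofReal_natCast]

theorem stmt14 : ∃ cμ : ℝ, 0 < cμ ∧ ∃ N : ℕ, ∀ n : ℕ, N ≤ n → ∀ μ : ℕ,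
    cμ * (Real.log n) ^ 2 ≤ (μ : ℝ) → μ ≤ n →
    uaMeasure n μ
      {ω |
        (∀ i : Fin n, ⌈uaCenter n μ 1⌉₊ < lab i →
          ∃ j : Fin n, lab j ≤ ⌈uaCenter n μ 1⌉₊ ∧ uaAdj n μ ω i j) ∧
        (∀ m : ℕ, 1 ≤ m → (m : ℝ) ≤ uaM n μ - 1 →
          ∀ i : Fin n, ⌈uaCenter n μ (m + 1)⌉₊ < lab i →
            (lab i : ℝ) < Real.exp 2 * uaCenter n μ m →
            ∃ j : Fin n, lab j ≤ ⌈uaCenter n μ (m + 1)⌉₊ ∧ uaAdj n μ ω i j) ∧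
        (∀ i : Fin n, 2 ≤ lab i → lab i ≤ 7 →
          ∃ j : Fin n, lab j = 1 ∧ uaAdj n μ ω i j)}
    ≥ 1 - 2 / (n : ℝ≥0∞) ^ 2 := by
  refine ⟨18, by norm_num, 3, fun n hn μ hμ _ => ?_⟩
  have hn' : (3 : ℝ) ≤ n := by exact_mod_cast hn
  have hlog : 1 ≤ Real.log n := by
    rw [Real.le_log_iff_exp_le (by linarith)]
    linarith [Real.exp_one_lt_d9]
  have hμlog : 18 * Real.log n ≤ μ := by nlinarith
  have hμ' : (0 : ℝ) < μ := by linarith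
  have hμpos : 0 < μ := by exact_mod_cast hμ'
  rw [ge_iff_le, tsub_le_iff_right]
  have : IsProbabilityMeasure (uaMeasure n μ) := by
    unfold uaMeasure
    infer_instance
  have hbad := (uaMeasure_iUnion_uaMissSet_le (by omega : 0 < n) hμpos).trans
    (ENNReal.div_le_div_right one_le_two _)
  rw [← measure_univ (μ := uaMeasure n μ)]
  refine (measure_mono ?_).trans ((measure_union_le _ _).trans (add_le_add_right hbad _))
  intro ω _
  refine or_iff_not_imp_right.mpr fun hω => ?_
  simp only [Set.mem_iUnion, not_exists] at hω
  have hcoef : 0 ≤ 3 * Real.log n / μ := by positivity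
  have hadj (i : Fin n) (hi : 2 ≤ lab i) (K : ℕ) (hK : 3 * Real.log n / μ * (i : ℕ) ≤ K) :
      ∃ j : Fin n, lab j ≤ K ∧ uaAdj n μ ω i j := by
    have hi0 : 0 < (i : ℕ) := by
      unfold lab at hi
      omega
    exact exists_uaAdj_of_notMem_uaMissSet hi0 (hω i hi0) (Nat.ceil_le.mpr hK)
  have hceil (m : ℕ) : 0 < ⌈uaCenter n μ m⌉₊ := Nat.ceil_pos.mpr (uaCenter_pos (by omega) hμpos m)
  refine ⟨fun i hi => ?_, fun m _ _ i hi him => ?_, fun i hi hi7 => ?_⟩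
  · refine hadj i (by have := hceil 1; omega) _ (le_trans ?_ (Nat.le_ceil _))
    rw [uaCenter_succ]
    refine mul_le_mul_of_nonneg_left ?_ hcoef
    have : ((i : ℕ) : ℝ) ≤ n := by exact_mod_cast i.2.le
    calc ((i : ℕ) : ℝ) ≤ n := this
      _ = Real.exp 2 * uaCenter n μ 0 := by
        simp only [uaCenter, pow_zero]
        field_simp
  · refine hadj i (by have := hceil (m + 1); omega) _ (le_trans ?_ (Nat.le_ceil _))
    rw [uaCenter_succ]
    refine mul_le_mul_of_nonneg_left ?_ hcoef
    simp only [lab, Nat.cast_add, Nat.cast_one] at him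
    linarith
  · obtain ⟨j, hj, hij⟩ := hadj i hi 1 <| by
      have hi6 : ((i : ℕ) : ℝ) ≤ 6 := by
        unfold lab at hi7
        exact_mod_cast (by omega : (i : ℕ) ≤ 6)
      calc 3 * Real.log n / μ * (i : ℕ) ≤ 3 * Real.log n / μ * 6 := by gcongr
        _ = 18 * Real.log n / μ := by ring
        _ ≤ ((1 : ℕ) : ℝ) := by rw [Nat.cast_one, div_le_one hμ']; exact hμlog
    exact ⟨j, le_antisymm hj (Nat.le_add_left 1 _), hij⟩
end

section
/- There is a constant c_μ such that the following holds for all n ≥ 2 and all μ ≥ c_μ·(ln n)². For G ← G_ua(n,μ) and any integer C with 2 ≤ C ≤ n, setting λ_C = μ·(H_{n−1} − H_{C−1}): with probability at least 1 − 4/n², every vertex i ≤ C has deg(i) > λ_C + μ/2 and every vertex i ≥ e²·C has deg(i) < λ_C + μ/2. Moreover, for C = 1: with probability at least 1 − 4/n², vertex 1 has deg(1) > λ₂ + μ/2 and every vertex i ≥ 7 has deg(i) < λ₂ + μ/2, where λ₂ = μ·(H_{n−1} − 1). -/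
open MeasureTheory
open scoped ENNReal

instance isProbabilityMeasure_uaCoord (i : ℕ) : IsProbabilityMeasure (uaCoord i) := by
  unfold uaCoord
  split_ifs <;> infer_instance

instance isProbabilityMeasure_uaMeasure (n μ : ℕ) : IsProbabilityMeasure (uaMeasure n μ) := by
  unfold uaMeasure
  infer_instance

lemma uaCoord_real_singleton {i j : ℕ} (h : i < j) : (uaCoord j).real {i} = 1 / (j : ℝ) := by
  have hj : 0 < j := by omega
  simp [uaCoord, hj, measureReal_def, PMF.toMeasure_apply_singleton,
    PMF.uniformOfFinset_apply, h]

lemma integral_uaCoord_weight_le {t : ℝ} (ht : |t| ≤ 1) {i j : ℕ} (h : i < j) :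
    ∫ k, (if k = i then Real.exp t else 1) ∂(uaCoord j)
      ≤ Real.exp (1 / (j : ℝ) * (t + t ^ 2)) := by
  have hfun : (fun k : ℕ => if k = i then Real.exp t else 1)
      = fun k => 1 + Set.indicator {i} (fun _ => Real.exp t - 1) k := by
    ext k
    by_cases hk : k = i <;> simp [hk]
  have hint : Integrable (Set.indicator {i} (fun _ => Real.exp t - 1)) (uaCoord j) :=
    (integrable_const _).indicator (measurableSet_singleton i)
  rw [hfun, integral_add (integrable_const _) hint,
    integral_indicator_const _ (measurableSet_singleton i), uaCoord_real_singleton h]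
  have hexp : Real.exp t - 1 ≤ t + t ^ 2 := by
    linarith [(abs_le.mp (Real.abs_exp_sub_one_sub_id_le ht)).2]
  have hmul : 1 / (j : ℝ) * (Real.exp t - 1) ≤ 1 / (j : ℝ) * (t + t ^ 2) :=
    mul_le_mul_of_nonneg_left hexp (by positivity)
  have := Real.add_one_le_exp (1 / (j : ℝ) * (t + t ^ 2))
  simp only [integral_const, probReal_univ, smul_eq_mul, mul_one]
  linarith

/-- The number of edges that later vertices attach to vertex `i`. -/
noncomputable def uaInDeg (n μ : ℕ) (ω : Fin n × Fin μ → ℕ) (i : Fin n) : ℕ :=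
  {p : Fin n × Fin μ | i < p.1 ∧ ω p = (i : ℕ)}.ncard

/-- The expected number of edges that later vertices attach to vertex `i`. -/
noncomputable def uaMeanInDeg (n μ : ℕ) (i : Fin n) : ℝ :=
  ∑ p : Fin n × Fin μ, if i < p.1 then 1 / ((p.1 : ℕ) : ℝ) else 0

/-- The factor that the choice `p` contributes to the exponential of the in-degree of `i`. -/
noncomputable def uaWeight {n μ : ℕ} (i : Fin n) (t : ℝ) (p : Fin n × Fin μ) (k : ℕ) : ℝ :=
  if i < p.1 ∧ k = (i : ℕ) then Real.exp t else 1

lemma exp_mul_uaInDeg (n μ : ℕ) (ω : Fin n × Fin μ → ℕ) (i : Fin n) (t : ℝ) :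
    Real.exp (t * uaInDeg n μ ω i) = ∏ p, uaWeight i t p (ω p) := by
  classical
  have hcard : uaInDeg n μ ω i
      = (Finset.univ.filter fun p : Fin n × Fin μ => i < p.1 ∧ ω p = (i : ℕ)).card := by
    rw [uaInDeg, ← Set.ncard_coe_finset]
    congr 1
    ext p
    simp
  simp only [uaWeight]
  rw [hcard, Finset.prod_ite, Finset.prod_const, Finset.prod_const_one, mul_one, mul_comm,
    Real.exp_nat_mul]

lemma integral_uaWeight_le {n μ : ℕ} (i : Fin n) {t : ℝ} (ht : |t| ≤ 1) (p : Fin n × Fin μ) :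
    ∫ k, uaWeight i t p k ∂(uaCoord p.1)
      ≤ Real.exp ((if i < p.1 then 1 / ((p.1 : ℕ) : ℝ) else 0) * (t + t ^ 2)) := by
  by_cases h : i < p.1
  · simpa [uaWeight, h] using integral_uaCoord_weight_le ht (Fin.lt_def.mp h)
  · simp [uaWeight, h]

lemma integrable_uaWeight {n μ : ℕ} (i : Fin n) (t : ℝ) (p : Fin n × Fin μ) :
    Integrable (uaWeight i t p) (uaCoord p.1) := by
  refine Integrable.of_bound (C := Real.exp t + 1)
    (measurable_of_countable _).aestronglyMeasurable (ae_of_all _ fun k => ?_)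
  have := Real.exp_pos t
  unfold uaWeight
  split_ifs
  · rw [Real.norm_of_nonneg this.le]; linarith
  · simp [this.le]

lemma uaMeasure_real_le_exp (n μ : ℕ) (i : Fin n) {t : ℝ} (ht : |t| ≤ 1) (x : ℝ) :
    (uaMeasure n μ).real {ω | x ≤ t * uaInDeg n μ ω i}
      ≤ Real.exp (uaMeanInDeg n μ i * (t + t ^ 2) - x) := by
  have hmgf : ∫ ω, ∏ p, uaWeight i t p (ω p) ∂(uaMeasure n μ)
      ≤ Real.exp (uaMeanInDeg n μ i * (t + t ^ 2)) := by
    rw [uaMeasure, integral_fintype_prod_eq_prod, uaMeanInDeg, Finset.sum_mul, Real.exp_sum]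
    refine Finset.prod_le_prod (fun p _ => integral_nonneg fun k => ?_)
      fun p _ => integral_uaWeight_le i ht p
    unfold uaWeight
    simp only [Pi.zero_apply]
    positivity
  have hint : Integrable (fun ω => ∏ p, uaWeight i t p (ω p)) (uaMeasure n μ) :=
    Integrable.fintype_prod (f := fun p => uaWeight i t p) fun p => integrable_uaWeight i t p
  have hmarkov := mul_meas_ge_le_integral_of_nonneg
    (ae_of_all _ fun ω => by
      simp only [Pi.zero_apply]
      rw [← exp_mul_uaInDeg]
      positivity) hint (Real.exp x)
  simp only [← exp_mul_uaInDeg, Real.exp_le_exp] at hmarkov hmgf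
  rw [Real.exp_sub, le_div_iff₀' (Real.exp_pos x)]
  exact hmarkov.trans hmgf

lemma harm_mono {a b : ℕ} (h : a ≤ b) : harm a ≤ harm b :=
  Finset.sum_le_sum_of_subset_of_nonneg (Finset.range_mono h) fun _ _ _ => by positivity

lemma harm_nonneg (k : ℕ) : 0 ≤ harm k :=
  Finset.sum_nonneg fun _ _ => by positivity

lemma harm_one : harm 1 = 1 := by simp [harm]

lemma log_sub_log_le_harm_sub {a b : ℕ} (h : a ≤ b) :
    Real.log (b + 1) - Real.log (a + 1) ≤ harm b - harm a := by
  induction b, h using Nat.le_induction with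
  | base => simp
  | succ b _ ih =>
    have hb : (0 : ℝ) < (b : ℝ) + 1 := by positivity
    have hstep : Real.log ((b : ℝ) + 1 + 1) - Real.log ((b : ℝ) + 1) ≤ 1 / ((b : ℝ) + 1) := by
      rw [← Real.log_div (by positivity) hb.ne']
      refine (Real.log_le_sub_one_of_pos (by positivity)).trans (le_of_eq ?_)
      field_simp
      ring
    have hsucc : harm (b + 1) = harm b + 1 / ((b : ℝ) + 1) := Finset.sum_range_succ _ _
    push_cast
    linarith

lemma harm_le_one_add_log (k : ℕ) : harm k ≤ 1 + Real.log k := by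
  convert harmonic_le_one_add_log k using 1
  simp [harm, harmonic]

lemma harm_pred_le_log {n : ℕ} (hn : 2 ≤ n) : harm (n - 1) ≤ 3 * Real.log n := by
  have hlog : Real.log ((n - 1 : ℕ) : ℝ) ≤ Real.log n :=
    Real.log_le_log (by exact_mod_cast (by omega : 0 < n - 1)) (by exact_mod_cast Nat.sub_le n 1)
  have hlog2 : Real.log 2 ≤ Real.log n := Real.log_le_log (by norm_num) (by exact_mod_cast hn)
  linarith [harm_le_one_add_log (n - 1), Real.log_two_gt_d9]

lemma uaMeanInDeg_eq (n μ : ℕ) (i : Fin n) :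
    uaMeanInDeg n μ i = (μ : ℝ) * (harm (n - 1) - harm i) := by
  have hi := i.isLt
  have hsum : ∑ j : Fin n, (if i < j then 1 / ((j : ℕ) : ℝ) else 0)
      = harm (n - 1) - harm i := by
    simp only [Fin.lt_def]
    rw [Fin.sum_univ_eq_sum_range (fun j => if (i : ℕ) < j then 1 / (j : ℝ) else 0) n,
      ← Finset.sum_filter, harm, harm, ← Finset.sum_Ico_eq_sub _ (by omega)]
    have hshift := Finset.sum_Ico_add' (fun k : ℕ => (1 : ℝ) / k) i (n - 1) 1
    push_cast at hshift
    rw [hshift]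
    refine Finset.sum_congr ?_ fun _ _ => rfl
    ext j
    simp only [Finset.mem_filter, Finset.mem_range, Finset.mem_Ico]
    omega
  rw [uaMeanInDeg, Fintype.sum_prod_type]
  simp only [Finset.sum_const, Finset.card_univ, Fintype.card_fin, nsmul_eq_mul]
  rw [← Finset.mul_sum, hsum]

lemma uaMeasure_inDeg_dist_ge_le {n μ : ℕ} (hn : 2 ≤ n)
    (hμ : 144 * (Real.log n) ^ 2 ≤ (μ : ℝ)) (i : Fin n) :
    (uaMeasure n μ).real {ω | (μ : ℝ) / 2 ≤ |(uaInDeg n μ ω i : ℝ) - uaMeanInDeg n μ i|}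
      ≤ 2 / (n : ℝ) ^ 3 := by
  set L := Real.log n with hL
  set m := uaMeanInDeg n μ i with hm
  have hL2 : 1 / 2 < L := by
    have : Real.log 2 ≤ L := Real.log_le_log (by norm_num) (by exact_mod_cast hn)
    linarith [Real.log_two_gt_d9]
  have hL0 : 0 < L := by linarith
  have hn0 : (0 : ℝ) < n := by exact_mod_cast (by omega : 0 < n)
  have hmL : m ≤ 3 * μ * L := by
    rw [hm, uaMeanInDeg_eq]
    have := harm_pred_le_log hn
    have := harm_nonneg i
    nlinarith [Nat.cast_nonneg (α := ℝ) μ]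
  set s := 1 / (12 * L) with hs
  have hsL : s * L = 1 / 12 := by rw [hs]; field_simp
  have hs0 : 0 < s := by positivity
  have hs1 : s ≤ 1 := by nlinarith
  have hbound : m * s ^ 2 - s * (μ / 2) ≤ -(3 * L) := by
    have h1 : m * s ^ 2 ≤ s * (μ / 4) := by
      calc m * s ^ 2 ≤ 3 * μ * L * s ^ 2 := by gcongr
        _ = s * (μ / 4) := by linear_combination 3 * (μ : ℝ) * s * hsL
    have h2 : s * (144 * L ^ 2) ≤ s * μ := by gcongr
    have h3 : s * (144 * L ^ 2) = 12 * L := by linear_combination 144 * L * hsL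
    linarith
  have hexp : Real.exp (-(3 * L)) = 1 / (n : ℝ) ^ 3 := by
    rw [Real.exp_neg, one_div, show 3 * L = ((3 : ℕ) : ℝ) * L by norm_num, Real.exp_nat_mul, hL,
      Real.exp_log hn0]
  have tail : ∀ t : ℝ, |t| = s →
      (uaMeasure n μ).real {ω | t * m + s * (μ / 2) ≤ t * uaInDeg n μ ω i} ≤ 1 / (n : ℝ) ^ 3 := by
    intro t ht
    refine (uaMeasure_real_le_exp n μ i (ht.trans_le hs1) _).trans ?_
    rw [← hexp, Real.exp_le_exp, ← sq_abs t, ht]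
    linarith
  have hsub : {ω | (μ : ℝ) / 2 ≤ |(uaInDeg n μ ω i : ℝ) - m|}
      ⊆ {ω | s * m + s * (μ / 2) ≤ s * uaInDeg n μ ω i}
        ∪ {ω | -s * m + s * (μ / 2) ≤ -s * uaInDeg n μ ω i} := by
    intro ω hω
    rcases le_abs.mp (Set.mem_ofPred_eq ▸ hω) with h | h
    · left
      have := mul_le_mul_of_nonneg_left h hs0.le
      simp only [Set.mem_ofPred_eq]
      linarith
    · right
      have := mul_le_mul_of_nonneg_left h hs0.le
      simp only [Set.mem_ofPred_eq]
      linarith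
  calc _ ≤ _ := measureReal_mono hsub
    _ ≤ _ := measureReal_union_le _ _
    _ ≤ 1 / (n : ℝ) ^ 3 + 1 / (n : ℝ) ^ 3 :=
      add_le_add (tail s (abs_of_pos hs0)) (tail (-s) (by rw [abs_neg, abs_of_pos hs0]))
    _ = 2 / (n : ℝ) ^ 3 := by ring

lemma uaMeasure_concentrated_ge {n μ : ℕ} (hn : 2 ≤ n)
    (hμ : 144 * (Real.log n) ^ 2 ≤ (μ : ℝ)) :
    1 - 4 / (n : ℝ≥0∞) ^ 2 ≤ uaMeasure n μ
      {ω | ∀ i : Fin n, |(uaInDeg n μ ω i : ℝ) - uaMeanInDeg n μ i| < (μ : ℝ) / 2} := by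
  have hn0 : (0 : ℝ) < n := by exact_mod_cast (by omega : 0 < n)
  set E := {ω | ∀ i : Fin n, |(uaInDeg n μ ω i : ℝ) - uaMeanInDeg n μ i| < (μ : ℝ) / 2} with hE
  have hcompl : Eᶜ = ⋃ i : Fin n,
      {ω | (μ : ℝ) / 2 ≤ |(uaInDeg n μ ω i : ℝ) - uaMeanInDeg n μ i|} := by
    ext ω
    simp [hE]
  have hreal : (uaMeasure n μ).real Eᶜ ≤ 4 / (n : ℝ) ^ 2 := by
    rw [hcompl]
    calc _ ≤ _ := measureReal_iUnion_fintype_le _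
      _ ≤ ∑ _i : Fin n, 2 / (n : ℝ) ^ 3 :=
        Finset.sum_le_sum fun i _ => uaMeasure_inDeg_dist_ge_le hn hμ i
      _ = 2 / (n : ℝ) ^ 2 := by
        simp
        field_simp
      _ ≤ 4 / (n : ℝ) ^ 2 := by gcongr; norm_num
  have henn : uaMeasure n μ Eᶜ ≤ 4 / (n : ℝ≥0∞) ^ 2 := by
    rw [← ofReal_measureReal]
    refine (ENNReal.ofReal_le_ofReal hreal).trans (le_of_eq ?_)
    rw [ENNReal.ofReal_div_of_pos (by positivity), ENNReal.ofReal_pow hn0.le]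
    simp
  rw [tsub_le_iff_right]
  calc 1 = uaMeasure n μ (E ∪ Eᶜ) := by rw [Set.union_compl_self, measure_univ]
    _ ≤ uaMeasure n μ E + uaMeasure n μ Eᶜ := measure_union_le _ _
    _ ≤ _ := by gcongr

lemma uaDeg_eq_of_pos {n μ : ℕ} (ω : Fin n × Fin μ → ℕ) {i : Fin n} (hi : 0 < (i : ℕ)) :
    (uaDeg n μ ω i : ℝ) = μ + uaInDeg n μ ω i := by
  simp [uaDeg, uaInDeg, hi]

lemma uaDeg_eq_of_zero {n μ : ℕ} (ω : Fin n × Fin μ → ℕ) {i : Fin n} (hi : (i : ℕ) = 0) :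
    uaDeg n μ ω i = uaInDeg n μ ω i := by
  simp [uaDeg, uaInDeg, hi]

lemma lt_uaDeg_of_concentrated {n μ : ℕ} {ω : Fin n × Fin μ → ℕ} {i : Fin n}
    (h : |(uaInDeg n μ ω i : ℝ) - uaMeanInDeg n μ i| < (μ : ℝ) / 2) {k : ℕ} (hk : 1 ≤ k)
    (hik : (i : ℕ) ≤ k) :
    (μ : ℝ) * (harm (n - 1) - harm k) + (μ : ℝ) / 2 < (uaDeg n μ ω i : ℝ) := by
  have hlow := (abs_lt.mp h).1
  rw [uaMeanInDeg_eq] at hlow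
  have hμ0 : (0 : ℝ) ≤ μ := Nat.cast_nonneg μ
  rcases Nat.eq_zero_or_pos (i : ℕ) with hi | hi
  · rw [uaDeg_eq_of_zero ω hi]
    have hk1 : 1 ≤ harm k := harm_one ▸ harm_mono hk
    have hi0 : harm (i : ℕ) = 0 := by simp [hi, harm]
    rw [hi0] at hlow
    nlinarith
  · rw [uaDeg_eq_of_pos ω hi]
    nlinarith [harm_mono hik]

lemma uaDeg_lt_of_concentrated {n μ : ℕ} {ω : Fin n × Fin μ → ℕ} {i : Fin n}
    (h : |(uaInDeg n μ ω i : ℝ) - uaMeanInDeg n μ i| < (μ : ℝ) / 2) (hi : 0 < (i : ℕ)) {k : ℕ}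
    (hik : 1 ≤ harm i - harm k) :
    (uaDeg n μ ω i : ℝ) < (μ : ℝ) * (harm (n - 1) - harm k) + (μ : ℝ) / 2 := by
  have hup := (abs_lt.mp h).2
  rw [uaMeanInDeg_eq] at hup
  rw [uaDeg_eq_of_pos ω hi]
  nlinarith [Nat.cast_nonneg (α := ℝ) μ]

lemma two_le_harm_sub_of_exp_mul_le {C i : ℕ} (hC : 1 ≤ C)
    (h : Real.exp 2 * (C : ℝ) ≤ (i : ℝ) + 1) : 2 ≤ harm i - harm (C - 1) := by
  have hC0 : (0 : ℝ) < C := by exact_mod_cast hC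
  have hCi : C ≤ i + 1 := by
    have h1 : (C : ℝ) ≤ Real.exp 2 * C :=
      le_mul_of_one_le_left hC0.le (Real.one_le_exp (by norm_num))
    exact_mod_cast h1.trans h
  have hlog := Real.log_le_log (by positivity) h
  rw [Real.log_mul (Real.exp_pos 2).ne' hC0.ne', Real.log_exp] at hlog
  have hdiff := log_sub_log_le_harm_sub (a := C - 1) (b := i) (by omega)
  rw [Nat.cast_sub hC, Nat.cast_one, sub_add_cancel] at hdiff
  linarith

theorem stmt15 : ∃ cμ : ℝ, 0 < cμ ∧ ∀ n : ℕ, 2 ≤ n → ∀ μ : ℕ,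
    cμ * (Real.log n) ^ 2 ≤ (μ : ℝ) →
    (∀ C : ℕ, 2 ≤ C → C ≤ n →
      uaMeasure n μ
        {ω | ∀ i : Fin n,
          (lab i ≤ C →
            (μ : ℝ) * (harm (n - 1) - harm (C - 1)) + (μ : ℝ) / 2 < (uaDeg n μ ω i : ℝ)) ∧
          (Real.exp 2 * (C : ℝ) ≤ (lab i : ℝ) →
            (uaDeg n μ ω i : ℝ) < (μ : ℝ) * (harm (n - 1) - harm (C - 1)) + (μ : ℝ) / 2)}
      ≥ 1 - 4 / (n : ℝ≥0∞) ^ 2) ∧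
    (uaMeasure n μ
        {ω |
          (∀ i : Fin n, lab i = 1 →
            (μ : ℝ) * (harm (n - 1) - harm 1) + (μ : ℝ) / 2 < (uaDeg n μ ω i : ℝ)) ∧
          (∀ i : Fin n, 7 ≤ lab i →
            (uaDeg n μ ω i : ℝ) < (μ : ℝ) * (harm (n - 1) - harm 1) + (μ : ℝ) / 2)}
      ≥ 1 - 4 / (n : ℝ≥0∞) ^ 2) := by
  refine ⟨144, by norm_num, fun n hn μ hμ => ⟨fun C hC _ => ?_, ?_⟩⟩
  · refine (uaMeasure_concentrated_ge hn hμ).trans (measure_mono fun ω hω i => ⟨fun hi => ?_,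
      fun hi => ?_⟩)
    · exact lt_uaDeg_of_concentrated (hω i) (by omega) (by unfold lab at hi; omega)
    · have hsub := two_le_harm_sub_of_exp_mul_le (C := C) (i := i) (by omega)
        (by simpa [lab] using hi)
      refine uaDeg_lt_of_concentrated (hω i) (Nat.pos_of_ne_zero fun h0 => ?_) (by linarith)
      have : harm (i : ℕ) = 0 := by simp [h0, harm]
      linarith [harm_nonneg (C - 1)]
  · refine (uaMeasure_concentrated_ge hn hμ).trans (measure_mono fun ω hω => ⟨fun i hi => ?_,
      fun i hi => ?_⟩)
    · exact lt_uaDeg_of_concentrated (hω i) le_rfl (by unfold lab at hi; omega)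
    · have hi6 : 6 ≤ (i : ℕ) := by unfold lab at hi; omega
      have h6 : (2 : ℝ) ≤ harm 6 := by norm_num [harm, Finset.sum_range_succ]
      refine uaDeg_lt_of_concentrated (hω i) (by omega) ?_
      linarith [harm_mono hi6, harm_one]
end
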